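/- (Mokri) Let (A₁, [·,·]₁, ρ₁) and (A₂, [·,·]₂, ρ₂) be Lie algebroids over A (algebraic form) equipped with a matched pair structure (∇←, ∇→). Then A₁ × A₂, with the bracket [(a,α),(b,β)] := ([a,b]₁ + ∇←_α b − ∇←_β a, [α,β]₂ + ∇→_a β − ∇→_b α) and the anchor ρ(a,α) := ρ₁(a) + ρ₂(α), is a Lie algebroid over A: the bracket is ℝ-bilinear and skew-symmetric, satisfies the Jacobi identity, and satisfies [(a,α), f·(b,β)] = (ρ(a,α)f)·(b,β) + f·[(a,α),(b,β)] for all f ∈ A. -/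

import Mathlib

/-- A Lie algebroid over a commutative ℝ-algebra `A` (algebraic form, i.e. a
Lie–Rinehart algebra): an `A`-module `L` with an ℝ-bilinear skew-symmetric bracket
satisfying the Jacobi identity, and an `A`-linear anchor into the ℝ-linear
derivations of `A` satisfying the Leibniz rule and compatible with brackets. -/
structure LieAlgebroid (A : Type*) [CommRing A] [Algebra ℝ A]
    (L : Type*) [AddCommGroup L] [Module ℝ L] [Module A L] [IsScalarTower ℝ A L] where
  br : L →ₗ[ℝ] L →ₗ[ℝ] L
  br_skew : ∀ a b : L, br a b = - br b a
  jacobi : ∀ a b c : L, br a (br b c) = br (br a b) c + br b (br a c)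
  anchor : L →ₗ[A] Derivation ℝ A A
  leibniz : ∀ (a b : L) (f : A), br a (f • b) = (anchor a f) • b + f • br a b
  anchor_br : ∀ (a b : L) (f : A),
    anchor (br a b) f = anchor a (anchor b f) - anchor b (anchor a f)

/-- A matched pair structure on two Lie algebroids `L₁`, `L₂` over `A`: ℝ-bilinear
flat connections `∇← = cl` and `∇→ = cr` satisfying the connection rules and the
two compatibility conditions. -/
structure LieMatchedPair (A : Type*) [CommRing A] [Algebra ℝ A]
    (L₁ : Type*) [AddCommGroup L₁] [Module ℝ L₁] [Module A L₁] [IsScalarTower ℝ A L₁]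
    (L₂ : Type*) [AddCommGroup L₂] [Module ℝ L₂] [Module A L₂] [IsScalarTower ℝ A L₂]
    (A₁ : LieAlgebroid A L₁) (A₂ : LieAlgebroid A L₂) where
  cl : L₂ →ₗ[ℝ] L₁ →ₗ[ℝ] L₁
  cr : L₁ →ₗ[ℝ] L₂ →ₗ[ℝ] L₂
  cl_smul_left : ∀ (f : A) (α : L₂) (b : L₁), cl (f • α) b = f • cl α b
  cl_leibniz : ∀ (α : L₂) (f : A) (b : L₁),
    cl α (f • b) = (A₂.anchor α f) • b + f • cl α b
  cr_smul_left : ∀ (f : A) (a : L₁) (β : L₂), cr (f • a) β = f • cr a β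
  cr_leibniz : ∀ (a : L₁) (f : A) (β : L₂),
    cr a (f • β) = (A₁.anchor a f) • β + f • cr a β
  cl_flat : ∀ (α β : L₂) (c : L₁),
    cl α (cl β c) - cl β (cl α c) = cl (A₂.br α β) c
  cr_flat : ∀ (a b : L₁) (γ : L₂),
    cr a (cr b γ) - cr b (cr a γ) = cr (A₁.br a b) γ
  compat₁ : ∀ (α : L₂) (b c : L₁),
    cl α (A₁.br b c)
      = A₁.br (cl α b) c + A₁.br b (cl α c) + cl (cr c α) b - cl (cr b α) c
  compat₂ : ∀ (a : L₁) (β γ : L₂),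
    cr a (A₂.br β γ)
      = A₂.br (cr a β) γ + A₂.br β (cr a γ) + cr (cl γ a) β - cr (cl β a) γ

section

variable {A : Type*} [CommRing A] [Algebra ℝ A]
  {L₁ : Type*} [AddCommGroup L₁] [Module ℝ L₁] [Module A L₁] [IsScalarTower ℝ A L₁]
  {L₂ : Type*} [AddCommGroup L₂] [Module ℝ L₂] [Module A L₂] [IsScalarTower ℝ A L₂]
  {A₁ : LieAlgebroid A L₁} {A₂ : LieAlgebroid A L₂}

/-- The matched-sum bracket on `L₁ × L₂`. -/
def mbr (P : LieMatchedPair A L₁ L₂ A₁ A₂) (x y : L₁ × L₂) : L₁ × L₂ :=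
  (A₁.br x.1 y.1 + P.cl x.2 y.1 - P.cl y.2 x.1,
   A₂.br x.2 y.2 + P.cr x.1 y.2 - P.cr y.1 x.2)

/-- The matched-sum anchor on `L₁ × L₂`. -/
def mrho (_P : LieMatchedPair A L₁ L₂ A₁ A₂) (x : L₁ × L₂) : Derivation ℝ A A :=
  A₁.anchor x.1 + A₂.anchor x.2

end

/-- (Mokri) The matched sum `A₁ × A₂` of a matched pair of Lie algebroids, with the
bracket `[(a,α),(b,β)] = ([a,b]₁ + ∇←_α b − ∇←_β a, [α,β]₂ + ∇→_a β − ∇→_b α)` and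
anchor `ρ(a,α) = ρ₁(a) + ρ₂(α)`, is a Lie algebroid over `A`: the bracket is
ℝ-bilinear, skew-symmetric, satisfies the Jacobi identity, and the Leibniz rule. -/
theorem matched_sum_lie_algebroid
    {A : Type*} [CommRing A] [Algebra ℝ A]
    {L₁ : Type*} [AddCommGroup L₁] [Module ℝ L₁] [Module A L₁] [IsScalarTower ℝ A L₁]
    {L₂ : Type*} [AddCommGroup L₂] [Module ℝ L₂] [Module A L₂] [IsScalarTower ℝ A L₂]
    {A₁ : LieAlgebroid A L₁} {A₂ : LieAlgebroid A L₂}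
    (P : LieMatchedPair A L₁ L₂ A₁ A₂) :
    (∀ x x' y : L₁ × L₂, mbr P (x + x') y = mbr P x y + mbr P x' y) ∧
    (∀ x y y' : L₁ × L₂, mbr P x (y + y') = mbr P x y + mbr P x y') ∧
    (∀ (r : ℝ) (x y : L₁ × L₂), mbr P (r • x) y = r • mbr P x y) ∧
    (∀ (r : ℝ) (x y : L₁ × L₂), mbr P x (r • y) = r • mbr P x y) ∧
    (∀ x y : L₁ × L₂, mbr P x y = - mbr P y x) ∧
    (∀ x y z : L₁ × L₂, mbr P x (mbr P y z) = mbr P (mbr P x y) z + mbr P y (mbr P x z)) ∧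
    (∀ (x y : L₁ × L₂) (f : A),
      mbr P x (f • y) = (mrho P x f) • y + f • mbr P x y) := by
  refine ⟨?_, ?_, ?_, ?_, ?_, ?_, ?_⟩
  · rintro ⟨a, α⟩ ⟨a', α'⟩ ⟨b, β⟩
    simp only [mbr, Prod.mk_add_mk, map_add, LinearMap.add_apply, Prod.mk.injEq]
    constructor <;> abel
  · rintro ⟨a, α⟩ ⟨b, β⟩ ⟨b', β'⟩
    simp only [mbr, Prod.mk_add_mk, map_add, LinearMap.add_apply, Prod.mk.injEq]
    constructor <;> abel
  · rintro r ⟨a, α⟩ ⟨b, β⟩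
    simp only [mbr, Prod.smul_mk, map_smul, LinearMap.smul_apply, smul_add, smul_sub]
  · rintro r ⟨a, α⟩ ⟨b, β⟩
    simp only [mbr, Prod.smul_mk, map_smul, LinearMap.smul_apply, smul_add, smul_sub]
  · rintro ⟨a, α⟩ ⟨b, β⟩
    simp only [mbr, Prod.neg_mk, Prod.mk.injEq]
    rw [A₁.br_skew a b, A₂.br_skew α β]
    constructor <;> abel
  · rintro ⟨a, α⟩ ⟨b, β⟩ ⟨c, γ⟩
    simp only [mbr, Prod.mk_add_mk, map_add, map_sub, LinearMap.add_apply,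
      LinearMap.sub_apply, Prod.mk.injEq]
    constructor
    · rw [A₁.jacobi a b c, P.compat₁ α b c, P.compat₁ β a c, P.compat₁ γ a b,
        ← P.cl_flat, ← P.cl_flat, ← P.cl_flat, A₁.br_skew (P.cl γ a) b]
      abel
    · rw [A₂.jacobi α β γ, P.compat₂ a β γ, P.compat₂ b α γ, P.compat₂ c α β,
        ← P.cr_flat, ← P.cr_flat, ← P.cr_flat, A₂.br_skew (P.cr c α) β]
      abel
  · rintro ⟨a, α⟩ ⟨b, β⟩ f
    simp only [mbr, mrho, Prod.smul_mk, Prod.mk_add_mk, A₁.leibniz, A₂.leibniz,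
      P.cl_leibniz, P.cr_leibniz, P.cl_smul_left, P.cr_smul_left, Derivation.add_apply,
      add_smul, smul_add, smul_sub, Prod.mk.injEq]
    constructor <;> abel
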